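/- Let A ∈ ℂ with Im A ≠ 0 and let B be a nonzero real number. Then the interval integral ∫_{-1}^{1} (A − B·z)⁻¹ dz (of the complex-valued function of the real variable z) equals (1/B) · Complex.log((A + B)/(A − B)), where Complex.log is the principal branch of the complex logarithm. -/

import Mathlib

/-- Two complex numbers with imaginary parts of the same sign have arguments differing by less
than `π`, so the principal logarithm of their quotient is the difference of logarithms. -/
theorem Complex.log_div_of_im_mul_im_pos {x y : ℂ} (h : 0 < x.im * y.im) :
    Complex.log (x / y) = Complex.log x - Complex.log y := by
  have hx : x ≠ 0 := by rintro rfl; simp at h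
  have hy : y ≠ 0 := by rintro rfl; simp at h
  have hexp : x / y = Complex.exp (Complex.log x - Complex.log y) := by
    rw [Complex.exp_sub, Complex.exp_log hx, Complex.exp_log hy]
  have harg : -Real.pi < x.arg - y.arg ∧ x.arg - y.arg < Real.pi := by
    rcases mul_pos_iff.mp h with ⟨h₁, h₂⟩ | ⟨h₁, h₂⟩
    · have hx₀ := Complex.arg_nonneg_iff.mpr h₁.le
      have hy₀ := Complex.arg_nonneg_iff.mpr h₂.le
      have hxπ := Complex.arg_lt_pi_iff.mpr (Or.inr h₁.ne')
      have hyπ := Complex.arg_lt_pi_iff.mpr (Or.inr h₂.ne')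
      constructor <;> linarith
    · have hx₀ := Complex.arg_neg_iff.mpr h₁
      have hy₀ := Complex.arg_neg_iff.mpr h₂
      have hxπ := Complex.neg_pi_lt_arg x
      have hyπ := Complex.neg_pi_lt_arg y
      constructor <;> linarith
  rw [hexp, Complex.log_exp]
  · simpa [Complex.log_im] using harg.1
  · simpa [Complex.log_im] using harg.2.le

/-- The master scalar integral `I₀(A,B) = ∫_{-1}^{1} dz/(A − Bz)` in complex
form: for `A ∈ ℂ` with nonzero imaginary part and a nonzero real `B`, it
equals `(1/B)·Log((A+B)/(A−B))` with the principal complex logarithm. -/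
theorem integral_I0_complex (A : ℂ) (hA : A.im ≠ 0) (B : ℝ) (hB : B ≠ 0) :
    (∫ z in (-1:ℝ)..1, (A - (B : ℂ) * (z : ℂ))⁻¹) =
      (1 / (B : ℂ)) * Complex.log ((A + (B : ℂ)) / (A - (B : ℂ))) := by
  have hBc : (B : ℂ) ≠ 0 := Complex.ofReal_ne_zero.mpr hB
  have hslit (z : ℝ) : A - (B : ℂ) * (z : ℂ) ∈ Complex.slitPlane := by
    refine Complex.mem_slitPlane_iff.mpr (Or.inr ?_)
    simpa using hA
  have hderiv (z : ℝ) : HasDerivAt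
      (fun z : ℝ => -(1 / (B : ℂ)) * Complex.log (A - (B : ℂ) * (z : ℂ)))
      (A - (B : ℂ) * (z : ℂ))⁻¹ z := by
    have hlin : HasDerivAt (fun z : ℝ => A - (B : ℂ) * (z : ℂ)) (-((B : ℂ) * 1)) z :=
      ((Complex.ofRealCLM.hasDerivAt (x := z)).const_mul (B : ℂ)).const_sub A
    refine ((hlin.clog_real (hslit z)).const_mul (-(1 / (B : ℂ)))).congr_deriv ?_
    have := Complex.slitPlane_ne_zero (hslit z)
    field_simp
  have hcont : Continuous fun z : ℝ => (A - (B : ℂ) * (z : ℂ))⁻¹ :=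
    Continuous.inv₀ (by fun_prop) fun z => Complex.slitPlane_ne_zero (hslit z)
  rw [intervalIntegral.integral_eq_sub_of_hasDerivAt (fun z _ => hderiv z)
    (hcont.intervalIntegrable _ _), Complex.log_div_of_im_mul_im_pos]
  · push_cast
    rw [mul_one, mul_neg_one, sub_neg_eq_add]
    ring
  · simpa using mul_self_pos.mpr hA
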